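/- Let (G, S, t) be a Hexasort instance whose stacks use a finite set C of colors, in which every stack height is at most t, and such that for every color c ∈ C appearing in S: the total height of all color-c stacks in S is at least t, and moreover either the last color-c stack in S has height t, or the total height of all color-c stacks in S of height strictly less than t is at least t. If G contains |C| pairwise vertex-disjoint induced subgraphs, each isomorphic to the spider consisting of a center vertex with three attached legs of lengths two, two, and one respectively, then S is emptyable on (G, t). -/

import Mathlib

open scoped Classical

namespace Hexasort

/-- A board configuration: each vertex holds either a stack `(color, height)` or nothing. -/
abbrev Config (V C : Type*) := V → Option (C × ℕ)

/-- The everywhere-empty configuration. -/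
def emptyConfig (V C : Type*) : Config V C := fun _ => none

/-- The height contributed by a board entry to color `c` (0 if empty or another color). -/
noncomputable def colorHeight {C : Type*} (e : Option (C × ℕ)) (c : C) : ℕ :=
  match e with
  | none => 0
  | some (c', h) => if c' = c then h else 0

/-- Total height of the color-`c` stacks on the neighbors of `x`. -/
noncomputable def neighborSum {V C : Type*} [Fintype V] (G : SimpleGraph V)
    (δ : Config V C) (c : C) (x : V) : ℕ :=
  ∑ y ∈ Finset.univ.filter (fun y => G.Adj x y), colorHeight (δ y) c

/-- The configuration resulting from placing the stack `s` on the vertex `x`: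
all same-colored neighbors are emptied, and `x` gets the merged stack unless
its total height reaches the threshold `t`, in which case `x` becomes empty. -/
noncomputable def place {V C : Type*} [Fintype V] (G : SimpleGraph V) (t : ℕ)
    (δ : Config V C) (s : C × ℕ) (x : V) : Config V C :=
  fun v =>
    if v = x then
      (if t ≤ s.2 + neighborSum G δ s.1 x then none
       else some (s.1, s.2 + neighborSum G δ s.1 x))
    else if G.Adj x v ∧ (∃ hh, δ v = some (s.1, hh)) then none
    else δ v

/-- Play a sequence of stacks on a sequence of vertices, starting from `δ`. -/
noncomputable def play {V C : Type*} [Fintype V] (G : SimpleGraph V) (t : ℕ) :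
    Config V C → List (C × ℕ) → List V → Config V C
  | δ, [], _ => δ
  | δ, _ :: _, [] => δ
  | δ, s :: S, x :: p => play G t (place G t δ s x) S p

/-- Legality of playing the stacks `S` on the vertices `p`, starting from `δ`:
each stack is placed on a vertex that is empty at that moment. -/
inductive Legal {V C : Type*} [Fintype V] (G : SimpleGraph V) (t : ℕ) :
    Config V C → List (C × ℕ) → List V → Prop
  | nil (δ : Config V C) : Legal G t δ [] []
  | cons {δ : Config V C} (s : C × ℕ) (S : List (C × ℕ)) (x : V) (p : List V) :
      δ x = none → Legal G t (place G t δ s x) S p →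
      Legal G t δ (s :: S) (x :: p)

/-- `S` is fittable on `(G, t)`: all stacks can be placed in order. -/
def Fittable {V C : Type*} [Fintype V] (G : SimpleGraph V) (t : ℕ)
    (S : List (C × ℕ)) : Prop :=
  ∃ p : List V, Legal G t (emptyConfig V C) S p

/-- `S` is emptyable on `(G, t)`: all stacks can be placed in order so that the
final configuration is everywhere empty. -/
def Emptyable {V C : Type*} [Fintype V] (G : SimpleGraph V) (t : ℕ)
    (S : List (C × ℕ)) : Prop :=
  ∃ p : List V, Legal G t (emptyConfig V C) S p ∧
    play G t (emptyConfig V C) S p = emptyConfig V C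

end Hexasort

namespace Hexasort

/-- The six-vertex spider with legs of lengths two, two, and one:
vertices `c, a1, b1, a2, b2, s` and edges `c–a1, a1–b1, c–a2, a2–b2, c–s`. -/
inductive SpiderT : Type
  | c | a1 | b1 | a2 | b2 | s
  deriving DecidableEq

instance instFintypeSpiderT : Fintype SpiderT where
  elems := ⟨([.c, .a1, .b1, .a2, .b2, .s] : List SpiderT), by simp⟩
  complete := by intro x; cases x <;> exact Multiset.mem_coe.mpr (by simp)

/-- The spider graph with legs of lengths two, two, and one. -/
def spiderTG : SimpleGraph SpiderT :=
  SimpleGraph.fromRel (fun u v =>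
    (u = .c ∧ v = .a1) ∨ (u = .a1 ∧ v = .b1) ∨ (u = .c ∧ v = .a2) ∨
    (u = .a2 ∧ v = .b2) ∨ (u = .c ∧ v = .s))

/-- Sum of the values of a spider state over the neighbors of a vertex. -/
def spSum (σ : SpiderT → ℕ) : SpiderT → ℕ
  | .c => σ .a1 + σ .a2 + σ .s
  | .a1 => σ .c + σ .b1
  | .b1 => σ .a1
  | .a2 => σ .c + σ .b2
  | .b2 => σ .a2
  | .s => σ .c

/-- Boolean adjacency of the spider. -/
def spAdj : SpiderT → SpiderT → Bool
  | .c, .a1 => true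
  | .c, .a2 => true
  | .c, .s => true
  | .a1, .c => true
  | .a2, .c => true
  | .s, .c => true
  | .a1, .b1 => true
  | .b1, .a1 => true
  | .a2, .b2 => true
  | .b2, .a2 => true
  | _, _ => false

theorem spAdj_iff (u v : SpiderT) : spiderTG.Adj u v ↔ spAdj u v = true := by
  cases u <;> cases v <;> simp [spiderTG, spAdj]

theorem spSum_eq (σ : SpiderT → ℕ) (u : SpiderT) :
    ∑ v : SpiderT, (if spAdj u v = true then σ v else 0) = spSum σ u := by
  have hu : (Finset.univ : Finset SpiderT) = {.c, .a1, .b1, .a2, .b2, .s} := by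
    ext x; cases x <;> simp
  rw [hu]
  cases u <;> simp [spAdj, spSum] <;> ring

/-- One move of the one-color game on the spider (0 means empty). -/
def spStep (t : ℕ) (σ : SpiderT → ℕ) (h : ℕ) (w : SpiderT) : SpiderT → ℕ := fun v =>
  if v = w then (if t ≤ h + spSum σ w then 0 else h + spSum σ w)
  else if spAdj w v = true then 0 else σ v

/-- The list of heights can be played from the state so that the end state is empty. -/
def Good (t : ℕ) : (SpiderT → ℕ) → List ℕ → Prop
  | σ, [] => ∀ v, σ v = 0
  | σ, h :: L => ∃ w, σ w = 0 ∧ Good t (spStep t σ h w) L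

/-- A spider state with empty center. -/
def st (a1 b1 s a2 b2 : ℕ) : SpiderT → ℕ
  | .c => 0
  | .a1 => a1
  | .b1 => b1
  | .a2 => a2
  | .b2 => b2
  | .s => s

/-- Merged height after threshold. -/
def cut (t n : ℕ) : ℕ := if t ≤ n then 0 else n

theorem step_a1 (t b1 s a2 b2 h : ℕ) :
    spStep t (st 0 b1 s a2 b2) h .a1 = st (cut t (h + b1)) 0 s a2 b2 := by
  funext v; cases v <;> simp [spStep, st, spSum, spAdj, cut]

theorem step_b1 (t a1 s a2 b2 h : ℕ) :
    spStep t (st a1 0 s a2 b2) h .b1 = st 0 (cut t (h + a1)) s a2 b2 := by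
  funext v; cases v <;> rfl

theorem step_a2 (t a1 b1 s b2 h : ℕ) :
    spStep t (st a1 b1 s 0 b2) h .a2 = st a1 b1 s (cut t (h + b2)) 0 := by
  funext v; cases v <;> simp [spStep, st, spSum, spAdj, cut]

theorem step_b2 (t a1 b1 s a2 h : ℕ) :
    spStep t (st a1 b1 s a2 0) h .b2 = st a1 b1 s 0 (cut t (h + a2)) := by
  funext v; cases v <;> rfl

theorem step_s (t a1 b1 a2 b2 h : ℕ) :
    spStep t (st a1 b1 0 a2 b2) h .s = st a1 b1 (cut t h) a2 b2 := by
  funext v; cases v <;> simp [spStep, st, spSum, spAdj, cut]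

theorem step_c (t a1 s a2 h : ℕ) (hh : t ≤ h + (a1 + a2 + s)) (v : SpiderT) :
    spStep t (st a1 0 s a2 0) h .c v = 0 := by
  cases v <;> simp [spStep, st, spSum, spAdj, hh]

theorem good_a1 {t b1 s a2 b2 h : ℕ} {L : List ℕ}
    (H : Good t (st (cut t (h + b1)) 0 s a2 b2) L) : Good t (st 0 b1 s a2 b2) (h :: L) :=
  ⟨.a1, rfl, by rwa [step_a1]⟩

theorem good_b1 {t a1 s a2 b2 h : ℕ} {L : List ℕ}
    (H : Good t (st 0 (cut t (h + a1)) s a2 b2) L) : Good t (st a1 0 s a2 b2) (h :: L) :=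
  ⟨.b1, rfl, by rwa [step_b1]⟩

theorem good_a2 {t a1 b1 s b2 h : ℕ} {L : List ℕ}
    (H : Good t (st a1 b1 s (cut t (h + b2)) 0) L) : Good t (st a1 b1 s 0 b2) (h :: L) :=
  ⟨.a2, rfl, by rwa [step_a2]⟩

theorem good_b2 {t a1 b1 s a2 h : ℕ} {L : List ℕ}
    (H : Good t (st a1 b1 s 0 (cut t (h + a2))) L) : Good t (st a1 b1 s a2 0) (h :: L) :=
  ⟨.b2, rfl, by rwa [step_b2]⟩

theorem good_s {t a1 b1 a2 b2 h : ℕ} {L : List ℕ}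
    (H : Good t (st a1 b1 (cut t h) a2 b2) L) : Good t (st a1 b1 0 a2 b2) (h :: L) :=
  ⟨.s, rfl, by rwa [step_s]⟩

theorem st_zero (v : SpiderT) : st 0 0 0 0 0 v = 0 := by cases v <;> rfl

/-- If the last stack has height `t`, toggling on one leg works. -/
theorem good_last_full (t : ℕ) (L : List ℕ) :
    (∀ r, Good t (st r 0 0 0 0) (L ++ [t])) ∧ (∀ r, Good t (st 0 r 0 0 0) (L ++ [t])) := by
  induction L with
  | nil =>
    constructor
    · intro r
      apply good_b1
      simpa [cut, Good] using st_zero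
    · intro r
      apply good_a1
      simpa [cut, Good] using st_zero
  | cons h L ih => exact ⟨fun r => good_b1 (ih.2 _), fun r => good_a1 (ih.1 _)⟩

/-- Phase one: an initial part can be accumulated on `a1`. -/
theorem good_start (t : ℕ) (P R : List ℕ) (H : ∀ r, Good t (st r 0 0 0 0) R) :
    Good t (st 0 0 0 0 0) (P ++ R) := by
  have key : (∀ r, Good t (st r 0 0 0 0) (P ++ R)) ∨ (∀ r, Good t (st 0 r 0 0 0) (P ++ R)) := by
    induction P with
    | nil => exact Or.inl H
    | cons h P ih =>
      rcases ih with ih | ih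
      · exact Or.inr fun r => good_a1 (ih _)
      · exact Or.inl fun r => good_b1 (ih _)
  rcases key with k | k <;> exact k 0

/-- Total of the entries of height below `t`. -/
def sm (t : ℕ) (L : List ℕ) : ℕ := (L.filter (fun h => h < t)).sum

theorem sm_cons_lt {t h : ℕ} (L : List ℕ) (hh : h < t) : sm t (h :: L) = h + sm t L := by
  simp [sm, hh]

theorem sm_cons_ge {t h : ℕ} (L : List ℕ) (hh : ¬ h < t) : sm t (h :: L) = sm t L := by
  simp only [sm]
  rw [List.filter_cons_of_neg (by simpa using hh)]

/-- Phase two: keep `q` on `s`, accumulate on the second leg, finish on the center. -/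
theorem good_phase_two (t q m : ℕ) (M : List ℕ) :
    (∀ r x, x + sm t M + m < t → t ≤ q + x + sm t M + m →
      Good t (st r 0 q x 0) (M ++ [m])) ∨
    (∀ r x, x + sm t M + m < t → t ≤ q + x + sm t M + m →
      Good t (st r 0 q 0 x) (M ++ [m])) := by
  induction M with
  | nil =>
    left
    intro r x _ h2
    refine ⟨.c, rfl, ?_⟩
    intro v
    apply step_c
    simp [sm] at h2
    omega
  | cons h M ih =>
    by_cases hh : h < t
    · rw [sm_cons_lt M hh]
      rcases ih with ih | ih
      · right
        intro r x h1 h2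
        apply good_a2
        rw [cut, if_neg (by omega)]
        exact ih _ _ (by omega) (by omega)
      · left
        intro r x h1 h2
        apply good_b2
        rw [cut, if_neg (by omega)]
        exact ih _ _ (by omega) (by omega)
    · rw [sm_cons_ge M hh]
      have hc : ∀ r, cut t (h + r) = 0 := fun r => by rw [cut, if_pos (by omega)]
      rcases ih with ih | ih
      · left
        intro r x h1 h2
        apply good_b1
        rw [hc]
        exact ih _ _ h1 h2
      · right
        intro r x h1 h2
        apply good_b1
        rw [hc]
        exact ih _ _ h1 h2

theorem split_list (t m : ℕ) (hm : m < t) (L : List ℕ) (hL : t ≤ sm t L + m) :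
    ∃ P q M, L = P ++ q :: M ∧ q < t ∧ sm t M + m < t ∧ t ≤ q + sm t M + m := by
  induction L with
  | nil => simp [sm] at hL; omega
  | cons h L ih =>
    by_cases h1 : t ≤ sm t L + m
    · obtain ⟨P, q, M, rfl, h2⟩ := ih h1
      exact ⟨h :: P, q, M, rfl, h2⟩
    · by_cases hh : h < t
      · rw [sm_cons_lt L hh] at hL
        exact ⟨[], h, L, rfl, hh, by omega, by omega⟩
      · rw [sm_cons_ge L hh] at hL
        omega

theorem good_of_small (t m : ℕ) (hm : m < t) (L : List ℕ) (hL : t ≤ sm t L + m) :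
    Good t (st 0 0 0 0 0) (L ++ [m]) := by
  obtain ⟨P, q, M, rfl, hq, h1, h2⟩ := split_list t m hm L hL
  rw [List.append_assoc]
  apply good_start
  intro r
  apply good_s
  rw [cut, if_neg (by omega)]
  rcases good_phase_two t q m M with k | k <;> exact k r 0 (by omega) (by omega)

theorem good_main (t : ℕ) (L : List ℕ) (hle : ∀ h ∈ L, h ≤ t)
    (H : L = [] ∨ L.getLast? = some t ∨ t ≤ sm t L) : Good t (fun _ => 0) L := by
  have h0 : (fun _ => 0 : SpiderT → ℕ) = st 0 0 0 0 0 := by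
    funext v; rw [st_zero]
  rw [h0]
  rcases List.eq_nil_or_concat L with rfl | ⟨L', m, rfl⟩
  · exact st_zero
  · rw [List.concat_eq_append] at *
    have hm : m ≤ t := hle m (by simp)
    rcases hm.lt_or_eq with hm | rfl
    · apply good_of_small t m hm
      rcases H with H | H | H
      · simp at H
      · simp at H; omega
      · simpa [sm, List.filter_append, hm] using H
    · exact (good_last_full m L').1 0

/-- Encoding of a height as board entry. -/
def enc {C : Type*} (c : C) (n : ℕ) : Option (C × ℕ) := if n = 0 then none else some (c, n)

/-- The board configuration is described by one spider state per color. -/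
def Rep {V C : Type*} (f : C → SpiderT → V) (σ : C → SpiderT → ℕ) (δ : Config V C) : Prop :=
  (∀ c w, δ (f c w) = enc c (σ c w)) ∧ (∀ v, (∀ c w, v ≠ f c w) → δ v = none)

theorem colorHeight_enc {C : Type*} (c c' : C) (n : ℕ) :
    colorHeight (enc c n) c' = if c = c' then n else 0 := by
  unfold enc
  by_cases hn : n = 0
  · simp [hn, colorHeight]
  · simp [hn, colorHeight]

theorem neighborSum_rep {V C : Type*} [Fintype V] (G : SimpleGraph V)
    (f : C → SpiderT → V)
    (hinj : Function.Injective (fun pr : C × SpiderT => f pr.1 pr.2))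
    (hind : ∀ (c : C) (w w' : SpiderT), G.Adj (f c w) (f c w') ↔ spiderTG.Adj w w')
    (σ : C → SpiderT → ℕ) (δ : Config V C) (hR : Rep f σ δ) (c : C) (w : SpiderT) :
    neighborSum G δ c (f c w) = spSum (σ c) w := by
  rw [← spSum_eq, neighborSum, Finset.sum_filter]
  symm
  have hfc : Function.Injective (f c) := fun a b h => by
    have := @hinj (c, a) (c, b) h
    exact (Prod.mk.inj this).2
  apply Finset.sum_of_injOn (f c) hfc.injOn (by simp)
  · intro v _ hv
    have hz : colorHeight (δ v) c = 0 := by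
      by_cases hx : ∃ c' w', v = f c' w'
      · obtain ⟨c', w', rfl⟩ := hx
        rw [hR.1, colorHeight_enc, if_neg]
        rintro rfl
        exact hv ⟨w', by simp, rfl⟩
      · push Not at hx
        rw [hR.2 v hx]
        rfl
    simp [hz]
  · intro v _
    simp [hind, spAdj_iff, hR.1, colorHeight_enc]

theorem rep_place {V C : Type*} [Fintype V] (G : SimpleGraph V) (t : ℕ)
    (f : C → SpiderT → V)
    (hinj : Function.Injective (fun pr : C × SpiderT => f pr.1 pr.2))
    (hind : ∀ (c : C) (w w' : SpiderT), G.Adj (f c w) (f c w') ↔ spiderTG.Adj w w')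
    (σ : C → SpiderT → ℕ) (δ : Config V C) (hR : Rep f σ δ) (c : C) (h : ℕ) (hh : 1 ≤ h)
    (w : SpiderT) :
    Rep f (Function.update σ c (spStep t (σ c) h w)) (place G t δ (c, h) (f c w)) := by
  have hns := neighborSum_rep G f hinj hind σ δ hR c w
  have hff : ∀ c' w', f c' w' = f c w ↔ c' = c ∧ w' = w := by
    intro c' w'
    constructor
    · intro e
      have := @hinj (c', w') (c, w) e
      exact Prod.mk.inj this
    · rintro ⟨rfl, rfl⟩; rfl
  constructor
  · intro c' w'
    simp only [place, hns, hff, hR.1]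
    by_cases hc : c' = c
    · subst hc
      simp only [Function.update_self, spStep, hind, spAdj_iff, true_and]
      by_cases hw : w' = w
      · simp only [hw, if_true]
        split_ifs
        · simp [enc]
        · rw [enc, if_neg (by omega)]
      · simp only [hw, if_false]
        by_cases ha : spAdj w w' = true
        · by_cases hz : σ c' w' = 0 <;> simp [ha, enc, hz]
        · simp [ha]
    · have : ¬ ∃ k, enc c' (σ c' w') = some (c, k) := by
        rintro ⟨k, hk⟩
        unfold enc at hk
        split_ifs at hk
        simp at hk
        exact hc hk.1
      simp [hc, this]
  · intro v hv
    simp [place, hv c w, hR.2 v hv]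

theorem combine {V C : Type*} [Fintype V] (G : SimpleGraph V) (t : ℕ)
    (f : C → SpiderT → V)
    (hinj : Function.Injective (fun pr : C × SpiderT => f pr.1 pr.2))
    (hind : ∀ (c : C) (w w' : SpiderT), G.Adj (f c w) (f c w') ↔ spiderTG.Adj w w')
    (S : List (C × ℕ)) (hpos : ∀ s ∈ S, 1 ≤ s.2)
    (σ : C → SpiderT → ℕ) (δ : Config V C) (hR : Rep f σ δ)
    (hG : ∀ c, Good t (σ c) ((S.filter (fun s => s.1 = c)).map Prod.snd)) :
    ∃ p : List V, Legal G t δ S p ∧ play G t δ S p = emptyConfig V C := by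
  induction S generalizing σ δ with
  | nil =>
    refine ⟨[], Legal.nil _, ?_⟩
    funext v
    simp only [play, emptyConfig]
    by_cases hx : ∃ c w, v = f c w
    · obtain ⟨c, w, rfl⟩ := hx
      rw [hR.1, enc, if_pos (hG c w)]
    · push Not at hx
      exact hR.2 v hx
  | cons s S ih =>
    obtain ⟨c, h⟩ := s
    have hg := hG c
    rw [List.filter_cons_of_pos (by simp)] at hg
    obtain ⟨w, hw, hg⟩ := hg
    have hR' := rep_place G t f hinj hind σ δ hR c h (hpos (c, h) (by simp)) w
    obtain ⟨p, hp1, hp2⟩ := ih (fun s hs => hpos s (by simp [hs])) _ _ hR' (by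
      intro c'
      by_cases hc : c' = c
      · subst hc
        rw [Function.update_self]
        exact hg
      · rw [Function.update_of_ne hc]
        have := hG c'
        rw [List.filter_cons_of_neg (by simpa using fun e => hc e.symm)] at this
        exact this)
    exact ⟨f c w :: p, Legal.cons _ _ _ _ (by rw [hR.1, hw]; rfl) hp1, hp2⟩

/-- if all heights are at most `t`, every color appearing in `S` has total
height at least `t` and moreover either its last stack has height `t` or its stacks of
height `< t` have total height at least `t`, and `G` contains `|C|` pairwise
vertex-disjoint induced spiders with legs of lengths two, two and one, then `S` is
emptyable. -/
theorem statement_13 {V C : Type*} [Fintype V] [Fintype C] (G : SimpleGraph V)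
    (t : ℕ) (ht : 1 ≤ t) (S : List (C × ℕ)) (hpos : ∀ s ∈ S, 1 ≤ s.2)
    (hle : ∀ s ∈ S, s.2 ≤ t)
    (hcolor : ∀ c : C, S.filter (fun s => s.1 = c) ≠ [] →
      t ≤ ((S.filter (fun s => s.1 = c)).map Prod.snd).sum ∧
      ((∃ s : C × ℕ, (S.filter (fun s => s.1 = c)).getLast? = some s ∧ s.2 = t) ∨
        t ≤ (((S.filter (fun s => s.1 = c)).filter (fun s => s.2 < t)).map
          Prod.snd).sum))
    (f : C → SpiderT → V)
    (hinj : Function.Injective (fun pr : C × SpiderT => f pr.1 pr.2))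
    (hind : ∀ (c : C) (w w' : SpiderT), G.Adj (f c w) (f c w') ↔ spiderTG.Adj w w') :
    Emptyable G t S := by
  refine combine G t f hinj hind S hpos (fun _ _ => 0) _ ⟨fun c w => rfl, fun v _ => rfl⟩ ?_
  intro c
  apply good_main
  · intro h hh
    obtain ⟨s, hs, rfl⟩ := List.mem_map.1 hh
    exact hle s (List.mem_filter.1 hs).1
  · by_cases hn : S.filter (fun s => s.1 = c) = []
    · left
      rw [hn]
      rfl
    · right
      rcases (hcolor c hn).2 with ⟨s, hs, rfl⟩ | hs
      · left
        rw [List.getLast?_map, hs]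
        rfl
      · right
        rw [sm, List.filter_map]
        exact hs

end Hexasort
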